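/- (Simplified Lorenz condition.) Let n ≥ 1 and let A be a real n×n matrix admitting a decomposition A = A_d + A_a^+ + A^z + A^s, where: A_d is a diagonal matrix with positive diagonal entries; A_a^+ has all entries non-negative and zero diagonal; A^z and A^s have all entries non-positive and zero diagonal. Assume: (1) A_d + A^z is invertible and every entry of (A_d + A^z)^{-1} is non-negative; (2) entrywise, A_a^+ ≤ A^z A_d^{-1} A^s; (3) there exists a vector e ∈ ℝ^n with all entries non-negative, e ≠ 0, such that every entry of A e is positive. Then A is invertible and every entry of A^{-1} is non-negative. -/

import Mathlib

open Matrix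

/-- If the off-diagonal entries of `B` are non-positive and `B e > 0` for some `e ≥ 0`,
then `B x ≥ 0` implies `x ≥ 0`. -/
theorem nonneg_of_mulVec_nonneg_of_offDiag_nonpos {ι : Type*} [Fintype ι]
    {B : Matrix ι ι ℝ} (hB : ∀ i j, i ≠ j → B i j ≤ 0) {e : ι → ℝ} (he : ∀ i, 0 ≤ e i)
    (hBe : ∀ i, 0 < (B *ᵥ e) i) {x : ι → ℝ} (hx : ∀ i, 0 ≤ (B *ᵥ x) i) (i : ι) :
    0 ≤ x i := by
  classical
  have row_nonpos : ∀ (y : ι → ℝ) (k : ι), (∀ j, 0 ≤ y j) → y k = 0 → (B *ᵥ y) k ≤ 0 := by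
    intro y k hy hk
    refine Finset.sum_nonpos fun j _ => ?_
    by_cases hkj : k = j
    · simp [← hkj, hk]
    · exact mul_nonpos_of_nonpos_of_nonneg (hB k j hkj) (hy j)
  have he_pos : ∀ k, 0 < e k := fun k =>
    (he k).lt_of_ne fun h => (row_nonpos e k he h.symm).not_gt (hBe k)
  have : Nonempty ι := ⟨i⟩
  obtain ⟨k, hk⟩ := Finite.exists_min fun j => x j / e j
  suffices h : 0 ≤ x k / e k by
    have := mul_nonneg (h.trans (hk i)) (he i)
    rwa [div_mul_cancel₀ _ (he_pos i).ne'] at this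
  by_contra! ht
  have hy := row_nonpos (x - (x k / e k) • e) k
    (fun j => by
      have := (le_div_iff₀ (he_pos j)).1 (hk j)
      simpa using this)
    (by simp [div_mul_cancel₀ _ (he_pos k).ne'])
  rw [mulVec_sub, mulVec_smul, Pi.sub_apply, Pi.smul_apply, smul_eq_mul] at hy
  linarith [hx k, mul_neg_of_neg_of_pos ht (hBe k)]

/-- A monotone square matrix is inverse-positive. -/
theorem isUnit_det_and_inv_nonneg_of_monotone {ι : Type*} [Fintype ι] [DecidableEq ι]
    {A : Matrix ι ι ℝ} (hA : ∀ x : ι → ℝ, (∀ i, 0 ≤ (A *ᵥ x) i) → ∀ i, 0 ≤ x i) :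
    IsUnit A.det ∧ ∀ i j, 0 ≤ A⁻¹ i j := by
  have hdet : IsUnit A.det := by
    rw [isUnit_iff_ne_zero]
    intro h
    obtain ⟨v, hv, hAv⟩ := exists_mulVec_eq_zero_iff.2 h
    refine hv (funext fun i => le_antisymm ?_ (hA v (by simp [hAv]) i))
    simpa using hA (-v) (by simp [mulVec_neg, hAv]) i
  refine ⟨hdet, fun i j => hA (fun k => A⁻¹ k j) (fun k => ?_) i⟩
  change 0 ≤ (A * A⁻¹) k j
  rw [mul_nonsing_inv _ hdet, one_apply]
  split_ifs <;> norm_num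

/-- An invertible matrix with non-negative entries maps positive vectors to positive vectors. -/
theorem mulVec_pos_of_isUnit_det_of_nonneg {ι : Type*} [Fintype ι] [DecidableEq ι]
    {P : Matrix ι ι ℝ} (hdet : IsUnit P.det) (hP : ∀ i j, 0 ≤ P i j) {v : ι → ℝ}
    (hv : ∀ i, 0 < v i) (i : ι) : 0 < (P *ᵥ v) i := by
  have hrow : ∃ j, P i j ≠ 0 := by
    by_contra! h
    exact hdet.ne_zero (det_eq_zero_of_row_eq_zero i h)
  obtain ⟨j, hj⟩ := hrow
  exact Finset.sum_pos' (fun k _ => mul_nonneg (hP i k) (hv k).le)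
    ⟨j, Finset.mem_univ j, mul_pos ((hP i j).lt_of_ne hj.symm) (hv j)⟩

/-- Theorem 3.6 in the paper (simplified Lorenz condition): if `A = A_d + A_a⁺ + A^z + A^s`
with `A_d` diagonal with positive diagonal, `A_a⁺ ≥ 0` with zero diagonal, `A^z, A^s ≤ 0`
with zero diagonal, `A_d + A^z` inverse-positive, `A_a⁺ ≤ A^z A_d⁻¹ A^s` entrywise, and
`A e > 0` entrywise for some non-negative non-zero vector `e`, then `A` is inverse-positive. -/
theorem inverse_positive_of_lorenz_condition
    (n : ℕ) (hn : 1 ≤ n)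
    (A Ad Ap Az As : Matrix (Fin n) (Fin n) ℝ)
    (hsplit : A = Ad + Ap + Az + As)
    (hAdDiag : ∀ i j, i ≠ j → Ad i j = 0)
    (hAdPos : ∀ i, 0 < Ad i i)
    (hApNonneg : ∀ i j, 0 ≤ Ap i j)
    (hApDiag : ∀ i, Ap i i = 0)
    (hAzNonpos : ∀ i j, Az i j ≤ 0)
    (hAzDiag : ∀ i, Az i i = 0)
    (hAsNonpos : ∀ i j, As i j ≤ 0)
    (hAsDiag : ∀ i, As i i = 0)
    (h1 : IsUnit (Ad + Az).det ∧ ∀ i j, 0 ≤ (Ad + Az)⁻¹ i j)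
    (h2 : ∀ i j, Ap i j ≤ (Az * Ad⁻¹ * As) i j)
    (h3 : ∃ e : Fin n → ℝ, (∀ i, 0 ≤ e i) ∧ e ≠ 0 ∧ ∀ i, 0 < A.mulVec e i) :
    IsUnit A.det ∧ ∀ i j, 0 ≤ A⁻¹ i j := by
  obtain ⟨hMdet, hMinv⟩ := h1
  obtain ⟨e, he, -, hAe⟩ := h3
  have hAd : Ad = diagonal fun i => Ad i i := by
    ext i j
    by_cases hij : i = j
    · simp [hij]
    · simp [hij, hAdDiag i j hij]
  have hAdInv : Ad⁻¹ = diagonal fun i => (Ad i i)⁻¹ := by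
    apply inv_eq_right_inv
    conv_lhs => rw [hAd]
    rw [diagonal_mul_diagonal, ← diagonal_one]
    congr 1
    funext i
    simp [(hAdPos i).ne']
  have hAdMul : Ad * Ad⁻¹ = 1 := by
    refine mul_nonsing_inv _ ?_
    rw [hAd, det_diagonal, isUnit_iff_ne_zero]
    exact Finset.prod_ne_zero_iff.2 fun i _ => (hAdPos i).ne'
  set M := Ad + Az with hM
  have hfactor : M * (1 + Ad⁻¹ * As) = A + (Az * Ad⁻¹ * As - Ap) := by
    rw [hsplit, hM, mul_add, mul_one, add_mul, ← Matrix.mul_assoc, ← Matrix.mul_assoc, hAdMul,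
      one_mul]
    abel
  have hMA : M⁻¹ * A = 1 + Ad⁻¹ * As - M⁻¹ * (Az * Ad⁻¹ * As - Ap) := by
    rw [eq_sub_iff_add_eq, ← mul_add, ← hfactor, nonsing_inv_mul_cancel_left _ _ hMdet]
  have hoff : ∀ i j, i ≠ j → (M⁻¹ * A) i j ≤ 0 := by
    intro i j hij
    have hcorr : 0 ≤ (M⁻¹ * (Az * Ad⁻¹ * As - Ap)) i j := by
      rw [mul_apply]
      exact Finset.sum_nonneg fun k _ => mul_nonneg (hMinv i k) (sub_nonneg.2 (h2 k j))
    have hscaled : (Ad⁻¹ * As) i j ≤ 0 := by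
      rw [hAdInv, diagonal_mul]
      exact mul_nonpos_of_nonneg_of_nonpos (inv_nonneg.2 (hAdPos i).le) (hAsNonpos i j)
    rw [hMA, Matrix.sub_apply, Matrix.add_apply, one_apply_ne hij]
    linarith
  refine isUnit_det_and_inv_nonneg_of_monotone fun x hx =>
    nonneg_of_mulVec_nonneg_of_offDiag_nonpos hoff he (fun i => ?_) fun i => ?_
  · rw [← mulVec_mulVec]
    exact mulVec_pos_of_isUnit_det_of_nonneg (isUnit_nonsing_inv_det _ hMdet) hMinv hAe i
  · rw [← mulVec_mulVec]
    exact dotProduct_nonneg_of_nonneg (hMinv i) hx
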